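/- Fix an integer g ≥ 0. For each n ≥ 1 with 3g−3+n ≥ 0, let C_n be a function from partitions to ℚ that vanishes on every partition λ unless all parts of λ lie in {2,…,n} and |λ| ≤ 3g−3+n, and define A_n := Σ_λ C_n(λ)·e_λ(x_1,…,x_n)·e_1(x_1,…,x_n)^{3g−3+n−|λ|} in ℚ[x_1,…,x_n]. Suppose the string equation holds: for every such n, A_{n+1}(x_1,…,x_n,0) = e_1(x_1,…,x_n)·A_n(x_1,…,x_n). Then for every n ≥ 1 with 3g−3+n ≥ 0 and every nonempty partition λ with all parts in {2,…,n} and |λ| ≤ 3g−3+n: if |λ| − max(λ) > 3g−3, then C_n(λ) = 0. -/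

import Mathlib

open MvPolynomial

/-- `e_λ = ∏_{a ∈ λ} e_a`, the product of elementary symmetric polynomials
indexed by the parts of the partition `p` (a multiset of positive integers). -/
noncomputable def esymmProd (n : ℕ) (p : Multiset ℕ) : MvPolynomial (Fin n) ℚ :=
  (p.map (esymm (Fin n) ℚ)).prod

/-- The amplitude `A_n = Σ_λ C(λ) · e_λ · e_1 ^ (3g-3+n-|λ|)` in `ℚ[x_1,…,x_n]`. -/
noncomputable def amplitude (g n : ℕ) (C : Multiset ℕ → ℚ) : MvPolynomial (Fin n) ℚ :=
  ∑ᶠ p : Multiset ℕ,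
    C p • (esymmProd n p * (esymm (Fin n) ℚ 1) ^ (3 * g + n - 3 - p.sum))

/-- Setting the last variable `x_{n+1}` to zero. -/
noncomputable def setLastZero (n : ℕ) :
    MvPolynomial (Fin (n + 1)) ℚ →ₐ[ℚ] MvPolynomial (Fin n) ℚ :=
  aeval (Fin.lastCases 0 X)


/-- `∏_{i ∈ s} e_{i+1}` is the value of `esymmAlgHom` at the monomial with exponent `s`. -/
lemma esymmAlgHom_monomial_toFinsupp (n : ℕ) (s : Multiset (Fin n)) :
    (esymmAlgHom (Fin n) ℚ n (monomial (Multiset.toFinsupp s) 1)).val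
      = esymmProd n (s.map fun i : Fin n => (i : ℕ) + 1) := by
  induction s using Multiset.induction_on with
  | empty => simp [esymmProd]
  | cons i s ih =>
    rw [← Multiset.singleton_add, map_add, ← one_mul (1 : ℚ), ← monomial_mul, map_mul,
      Subalgebra.coe_mul, ih, Multiset.toFinsupp_singleton, esymmAlgHom_apply,
      aeval_monomial]
    simp [esymmProd]

/-- Products of the elementary symmetric polynomials `e_1, …, e_n` in `n` variables are linearly
independent. -/
lemma linearIndepOn_esymmProd (n : ℕ) :
    LinearIndepOn ℚ (esymmProd n) {q | ∀ a ∈ q, 1 ≤ a ∧ a ≤ n} := by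
  have hinj : Function.Injective fun i : Fin n => (i : ℕ) + 1 := fun i j h => by
    simpa [Fin.ext_iff] using h
  have hrange : {q : Multiset ℕ | ∀ a ∈ q, 1 ≤ a ∧ a ≤ n}
      ⊆ Set.range (Multiset.map fun i : Fin n => (i : ℕ) + 1) := by
    intro q hq
    refine Quot.inductionOn q (fun l hl => ?_) hq
    obtain ⟨l', rfl⟩ : l ∈ Set.range (List.map fun i : Fin n => (i : ℕ) + 1) := by
      rw [Set.range_list_map]
      intro a ha
      obtain ⟨h1, h2⟩ := hl a (by simpa using ha)
      exact ⟨⟨a - 1, by omega⟩, by simp; omega⟩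
    exact ⟨(l' : Multiset (Fin n)), by simp⟩
  refine LinearIndepOn.mono ?_ hrange
  rw [linearIndepOn_range_iff (Multiset.map_injective hinj)]
  have h := ((basisMonomials (Fin n) ℚ).linearIndependent.comp _
    (Multiset.toFinsupp (α := Fin n)).injective).map'
    ((symmetricSubalgebra (Fin n) ℚ).val.comp (esymmAlgHom (Fin n) ℚ n)).toLinearMap
    (LinearMap.ker_eq_bot.2 (Subtype.val_injective.comp
      (esymmAlgHom_fin_injective ℚ le_rfl)))
  rwa [show esymmProd n ∘ Multiset.map (fun i : Fin n => (i : ℕ) + 1) = _ from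
    funext fun s => (esymmAlgHom_monomial_toFinsupp n s).symm]

/-- The last variable set to zero, `e_k` in `n + 1` variables becomes `e_k` in `n` variables. -/
lemma setLastZero_esymm (n k : ℕ) :
    setLastZero n (esymm (Fin (n + 1)) ℚ k) = esymm (Fin n) ℚ k := by
  have h : (Finset.univ.val.map (Fin.lastCases 0 X : Fin (n + 1) → MvPolynomial (Fin n) ℚ))
      = 0 ::ₘ Finset.univ.val.map X := by
    rw [Fin.univ_castSuccEmb]
    simp [Function.comp_def]
  rw [setLastZero, aeval_esymm_eq_multiset_esymm, h, esymm_eq_multiset_esymm]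
  cases k with
  | zero => simp [Multiset.esymm]
  | succ k => simp only [Multiset.esymm, Multiset.powersetCard_cons, Multiset.map_add,
      Multiset.map_map, Function.comp_apply, Multiset.prod_cons, zero_mul, Multiset.sum_add,
      Multiset.map_const', Multiset.sum_replicate, smul_zero, add_zero]

lemma setLastZero_esymmProd (n : ℕ) (p : Multiset ℕ) :
    setLastZero n (esymmProd (n + 1) p) = esymmProd n p := by
  simp [esymmProd, map_multiset_prod, Multiset.map_map, setLastZero_esymm]

lemma esymmProd_eq_zero {n a : ℕ} {p : Multiset ℕ} (ha : a ∈ p) (hn : n < a) :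
    esymmProd n p = 0 := by
  refine Multiset.prod_eq_zero (Multiset.mem_map.2 ⟨a, ha, ?_⟩)
  simp [esymm, Finset.powersetCard_eq_empty.2, hn]

lemma esymmProd_mul_esymm_one_pow (n k : ℕ) (p : Multiset ℕ) :
    esymmProd n p * esymm (Fin n) ℚ 1 ^ k = esymmProd n (p + Multiset.replicate k 1) := by
  simp [esymmProd]

/-- There are finitely many partitions of bounded size. -/
lemma finite_setOf_sum_le (N : ℕ) : {p : Multiset ℕ | (∀ a ∈ p, 1 ≤ a) ∧ p.sum ≤ N}.Finite := by
  refine (Set.finite_Iic (N • Multiset.range (N + 1))).subset ?_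
  rintro p ⟨hp, hs⟩
  rw [Set.mem_Iic, Multiset.le_iff_count]
  intro a
  by_cases ha : a ∈ p
  · have h1 : a ≤ N := (Multiset.single_le_sum (by simp) a ha).trans hs
    have h2 : p.card ≤ p.sum := by
      simpa using Multiset.card_nsmul_le_sum (a := 1) hp
    rw [Multiset.count_nsmul, Multiset.count_eq_one_of_mem (Multiset.nodup_range _) (by simp; omega)]
    have := Multiset.count_le_card a p
    omega
  · simp [Multiset.count_eq_zero_of_notMem ha]

/-- Homogenising by powers of `e_1` keeps products of `e_2, …, e_n` linearly independent. -/
lemma linearIndepOn_esymmProd_mul_pow {n : ℕ} (hn : 1 ≤ n) (k : Multiset ℕ → ℕ) :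
    LinearIndepOn ℚ (fun p => esymmProd n p * esymm (Fin n) ℚ 1 ^ k p)
      {p | ∀ a ∈ p, 2 ≤ a ∧ a ≤ n} := by
  have hfilter : ∀ p : Multiset ℕ, (∀ a ∈ p, 2 ≤ a ∧ a ≤ n) →
      (p + Multiset.replicate (k p) 1).filter (2 ≤ ·) = p := by
    intro p hp
    rw [Multiset.filter_add, Multiset.filter_eq_self.2 fun a ha => (hp a ha).1,
      Multiset.filter_eq_nil.2 (fun a ha => by simp [Multiset.eq_of_mem_replicate ha]), add_zero]
  simp_rw [esymmProd_mul_esymm_one_pow]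
  refine (linearIndepOn_esymmProd n).linearIndependent.comp
    (fun p : {p : Multiset ℕ | ∀ a ∈ p, 2 ≤ a ∧ a ≤ n} =>
      ⟨(p : Multiset ℕ) + Multiset.replicate (k p) 1, fun a ha => ?_⟩) fun p q h => Subtype.ext ?_
  · rcases Multiset.mem_add.1 ha with h | h
    · have := p.2 a h
      omega
    · rw [Multiset.eq_of_mem_replicate h]
      omega
  · rw [← hfilter p p.2, ← hfilter q q.2]
    exact congrArg _ (congrArg Subtype.val h)

/-- The string equation says that `C_{n+1}` and `C_n` agree on partitions with parts in
`{2, …, n}`. -/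
lemma coeff_succ_eq_of_string {g n : ℕ} (hn : 1 ≤ n) (hg : 3 ≤ 3 * g + n) {C D : Multiset ℕ → ℚ}
    (hC : ∀ p : Multiset ℕ, ¬ ((∀ a ∈ p, 2 ≤ a ∧ a ≤ n) ∧ p.sum + 3 ≤ 3 * g + n) → C p = 0)
    (hD : ∀ p : Multiset ℕ,
      ¬ ((∀ a ∈ p, 2 ≤ a ∧ a ≤ n + 1) ∧ p.sum + 3 ≤ 3 * g + (n + 1)) → D p = 0)
    (hstring : setLastZero n (amplitude g (n + 1) D) = esymm (Fin n) ℚ 1 * amplitude g n C)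
    {p : Multiset ℕ} (hp : ∀ a ∈ p, 2 ≤ a ∧ a ≤ n) : D p = C p := by
  set d := 3 * g + (n + 1) - 3 with hd
  set S := (finite_setOf_sum_le d).toFinset
  have hDS : ∀ q, D q ≠ 0 → q ∈ S := by
    intro q hq
    obtain ⟨h1, h2⟩ := not_not.1 (mt (hD q) hq)
    exact (Set.Finite.mem_toFinset _).2 ⟨fun a ha => by have := h1 a ha; omega, by omega⟩
  have hCS : ∀ q, C q ≠ 0 → q ∈ S := by
    intro q hq
    obtain ⟨h1, h2⟩ := not_not.1 (mt (hC q) hq)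
    exact (Set.Finite.mem_toFinset _).2 ⟨fun a ha => by have := h1 a ha; omega, by omega⟩
  have hleft : setLastZero n (amplitude g (n + 1) D)
      = ∑ q ∈ S, D q • (esymmProd n q * esymm (Fin n) ℚ 1 ^ (d - q.sum)) := by
    rw [amplitude, finsum_eq_sum_of_support_subset (s := S), map_sum]
    · simp only [map_smul, map_mul, map_pow, setLastZero_esymmProd, setLastZero_esymm, hd]
    · intro q hq
      exact hDS q (left_ne_zero_of_smul hq)
  have hright : esymm (Fin n) ℚ 1 * amplitude g n C
      = ∑ q ∈ S, C q • (esymmProd n q * esymm (Fin n) ℚ 1 ^ (d - q.sum)) := by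
    rw [amplitude, finsum_eq_sum_of_support_subset (s := S), Finset.mul_sum]
    · refine Finset.sum_congr rfl fun q _ => ?_
      by_cases hq : C q = 0
      · simp [hq]
      · obtain ⟨-, h2⟩ := not_not.1 (mt (hC q) hq)
        rw [show d - q.sum = 3 * g + n - 3 - q.sum + 1 by omega, pow_succ, mul_smul_comm]
        ring_nf
    · intro q hq
      exact hCS q (left_ne_zero_of_smul hq)
  set T := {q ∈ S | ∀ a ∈ q, 2 ≤ a ∧ a ≤ n}
  have hsum : ∑ q ∈ T, (D q - C q) • (esymmProd n q * esymm (Fin n) ℚ 1 ^ (d - q.sum)) = 0 := by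
    rw [← sub_eq_zero, hleft, hright, ← Finset.sum_sub_distrib] at hstring
    rw [← hstring]
    simp_rw [← sub_smul]
    refine Finset.sum_subset (Finset.filter_subset _ _) fun q hqS hqT => ?_
    by_cases hlarge : ∃ a ∈ q, n < a
    · obtain ⟨a, ha, hna⟩ := hlarge
      simp [esymmProd_eq_zero ha hna]
    · push Not at hlarge
      have hq : ¬ ∀ a ∈ q, 2 ≤ a ∧ a ≤ n := fun h => hqT (Finset.mem_filter.2 ⟨hqS, h⟩)
      rw [hC q fun h => hq h.1,
        hD q fun h => hq fun a ha => ⟨(h.1 a ha).1, hlarge a ha⟩, sub_zero, zero_smul]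
  by_cases hpS : p ∈ S
  · have hlin := (linearIndepOn_esymmProd_mul_pow hn fun q => d - q.sum).mono
      (show (T : Set (Multiset ℕ)) ⊆ {q | ∀ a ∈ q, 2 ≤ a ∧ a ≤ n} from
        fun q hq => (Finset.mem_filter.1 hq).2)
    exact sub_eq_zero.1
      (linearIndepOn_finset_iff.1 hlin _ hsum p (Finset.mem_filter.2 ⟨hpS, hp⟩))
  · rw [not_imp_comm.1 (hDS p) hpS, not_imp_comm.1 (hCS p) hpS]

/-- Lemma 3.2 (lem:1): the string equation implies `C_n(λ) = 0` for every nonempty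
partition `λ` (with parts in `{2,…,n}` and `|λ| ≤ 3g-3+n`) with `|λ| - max(λ) > 3g-3`,
i.e. `|λ| + 3 > 3g + max(λ)`. -/
theorem string_coeff_vanish_large_tail (g : ℕ) (C : ℕ → Multiset ℕ → ℚ)
    (hvan : ∀ n, 1 ≤ n → 3 ≤ 3 * g + n → ∀ p : Multiset ℕ,
      ¬ ((∀ a ∈ p, 2 ≤ a ∧ a ≤ n) ∧ p.sum + 3 ≤ 3 * g + n) → C n p = 0)
    (hstring : ∀ n, 1 ≤ n → 3 ≤ 3 * g + n →
      setLastZero n (amplitude g (n + 1) (C (n + 1)))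
        = esymm (Fin n) ℚ 1 * amplitude g n (C n)) :
    ∀ n, 1 ≤ n → 3 ≤ 3 * g + n → ∀ p : Multiset ℕ, p ≠ 0 →
      (∀ a ∈ p, 2 ≤ a ∧ a ≤ n) → p.sum + 3 ≤ 3 * g + n →
      3 * g + p.sup < p.sum + 3 →
      C n p = 0 := by
  intro n hn
  induction n, hn using Nat.le_induction with
  | base =>
    intro _ p hp hparts
    obtain ⟨a, ha⟩ := Multiset.exists_mem_of_ne_zero hp
    have := hparts a ha
    omega
  | succ n hn ih =>
    intro hg p hp hparts hsum hsup
    obtain ⟨b, hb⟩ := Multiset.exists_mem_of_ne_zero hp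
    have hb_sum : b ≤ p.sum := Multiset.single_le_sum (by simp) b hb
    have hb_two := (hparts b hb).1
    have hg' : 3 ≤ 3 * g + n := by omega
    have hsmall : ∀ a ∈ p, 2 ≤ a ∧ a ≤ n := by
      intro a ha
      have := hparts a ha
      have := Multiset.le_sup ha
      omega
    rw [coeff_succ_eq_of_string hn hg' (hvan n hn hg') (hvan (n + 1) (by omega) hg)
      (hstring n hn hg') hsmall]
    by_cases hle : p.sum + 3 ≤ 3 * g + n
    · exact ih hg' p hp hsmall hle hsup
    · exact hvan n hn hg' p fun h => hle h.2
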